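/- The lattice P₁₂ = (ℤ¹², −2·I₁₂) admits no primitive embedding into Γ^{3,19}: there is no injective ℤ-linear map T : ℤ¹² → ℤ²² with (Tx)ᵀG(Ty) = −2·xᵀy for all x,y (G the Gram matrix of Γ^{3,19}) such that ℤ²²/T(ℤ¹²) is torsion-free. -/

import Mathlib

open Matrix

/-- The hyperbolic plane `U`, the rank-2 even unimodular lattice of signature (1,1). -/
def matU : Matrix (Fin 2) (Fin 2) ℤ := !![0, 1; 1, 0]

/-- The negative of the `E8` Cartan matrix: the Gram matrix of `E8(−1)`. -/
def matE8neg : Matrix (Fin 8) (Fin 8) ℤ :=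
  -(!![2, 0, -1, 0, 0, 0, 0, 0;
       0, 2, 0, -1, 0, 0, 0, 0;
       -1, 0, 2, -1, 0, 0, 0, 0;
       0, -1, -1, 2, -1, 0, 0, 0;
       0, 0, 0, -1, 2, -1, 0, 0;
       0, 0, 0, 0, -1, 2, -1, 0;
       0, 0, 0, 0, 0, -1, 2, -1;
       0, 0, 0, 0, 0, 0, -1, 2])

/-- Block-diagonal (orthogonal) sum of two integer Gram matrices. -/
def blockSum {a b : ℕ} (A : Matrix (Fin a) (Fin a) ℤ) (B : Matrix (Fin b) (Fin b) ℤ) :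
    Matrix (Fin (a + b)) (Fin (a + b)) ℤ :=
  Matrix.reindex finSumFinEquiv finSumFinEquiv (Matrix.fromBlocks A 0 0 B)

/-- The Gram matrix of `Γ^{3,19} = U ⊕ U ⊕ U ⊕ E8(−1) ⊕ E8(−1)`. -/
def GammaGram : Matrix (Fin 22) (Fin 22) ℤ :=
  blockSum matU (blockSum matU (blockSum matU (blockSum matE8neg matE8neg)))

lemma isUnit_det_blockSum {a b : ℕ} {A : Matrix (Fin a) (Fin a) ℤ} {B : Matrix (Fin b) (Fin b) ℤ}
    (hA : IsUnit A.det) (hB : IsUnit B.det) : IsUnit (blockSum A B).det := by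
  rw [blockSum, Matrix.det_reindex_self, Matrix.det_fromBlocks_zero₂₁]
  exact hA.mul hB

lemma isUnit_det_matU : IsUnit matU.det := by
  simp [matU, Matrix.det_fin_two]

lemma isUnit_det_matE8neg : IsUnit matE8neg.det := by
  refine Matrix.isUnit_det_of_right_inverse (B := !![-4, -5, -7, -10, -8, -6, -4, -2;
       -5, -8, -10, -15, -12, -9, -6, -3;
       -7, -10, -14, -20, -16, -12, -8, -4;
       -10, -15, -20, -30, -24, -18, -12, -6;
       -8, -12, -16, -24, -20, -15, -10, -5;
       -6, -9, -12, -18, -15, -12, -8, -4;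
       -4, -6, -8, -12, -10, -8, -6, -3;
       -2, -3, -4, -6, -5, -4, -3, -2]) ?_
  unfold matE8neg
  decide +kernel

lemma isUnit_det_GammaGram : IsUnit GammaGram.det :=
  isUnit_det_blockSum isUnit_det_matU (isUnit_det_blockSum isUnit_det_matU
    (isUnit_det_blockSum isUnit_det_matU
      (isUnit_det_blockSum isUnit_det_matE8neg isUnit_det_matE8neg)))

/-- The lattice `P₁₂ = (ℤ¹², −2·I₁₂)` admits no primitive embedding into `Γ^{3,19}`:
there is no injective `ℤ`-linear map `T : ℤ¹² → ℤ²²` with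
`(Tx)ᵀ G (Ty) = −2·xᵀy` for all `x, y` whose cokernel is torsion-free. -/
theorem no_primitive_embedding_P12 :
    ¬ ∃ T : Matrix (Fin 22) (Fin 12) ℤ,
      Function.Injective T.mulVec ∧
      (∀ x y : Fin 12 → ℤ,
        T.mulVec x ⬝ᵥ GammaGram.mulVec (T.mulVec y) = -2 * (x ⬝ᵥ y)) ∧
      (∀ (v : Fin 22 → ℤ) (k : ℤ), k ≠ 0 →
        (∃ x, T.mulVec x = k • v) → ∃ x, T.mulVec x = v) := by
  rintro ⟨T, hinj, hform, hprim⟩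
  let f : ℤ →+* ZMod 2 := Int.castRingHom (ZMod 2)
  let T2 : Matrix (Fin 22) (Fin 12) (ZMod 2) := T.map f
  let G2 : Matrix (Fin 22) (Fin 22) (ZMod 2) := GammaGram.map f
  have hG2 : IsUnit G2.det := by
    have h : G2.det = f GammaGram.det := (RingHom.map_det f GammaGram).symm
    rw [h]
    exact isUnit_det_GammaGram.map f
  -- the reduction of `T` modulo 2 is injective, by primitivity
  have hT2 : Function.Injective T2.mulVecLin := by
    rw [← LinearMap.ker_eq_bot, LinearMap.ker_eq_bot']
    intro y hy
    have hlift : ∃ x : Fin 12 → ℤ, (fun i => f (x i)) = y := by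
      choose x hx using fun i => ZMod.intCast_surjective (y i)
      exact ⟨x, funext hx⟩
    obtain ⟨x, rfl⟩ := hlift
    have hdvd : ∀ i, (2 : ℤ) ∣ T.mulVec x i := by
      intro i
      have h1 : f (T.mulVec x i) = 0 := by
        rw [RingHom.map_mulVec]
        exact congrFun hy i
      exact (ZMod.intCast_zmod_eq_zero_iff_dvd _ 2).1 h1
    choose v hv using hdvd
    obtain ⟨z, hz⟩ := hprim v 2 two_ne_zero ⟨x, by ext i; simpa using hv i⟩
    have hx : x = (2 : ℤ) • z := by
      apply hinj
      rw [Matrix.mulVec_smul, hz]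
      ext i
      simpa using hv i
    ext i
    rw [hx]
    exact (ZMod.intCast_zmod_eq_zero_iff_dvd _ 2).2 ⟨z i, by simp⟩
  have hrank : T2.rank = 12 := by
    rw [Matrix.rank, LinearMap.finrank_range_of_inj hT2]
    simp
  -- the image of the reduction is totally isotropic
  have hTGT : Tᵀ * (GammaGram * T) = (-2 : ℤ) • (1 : Matrix (Fin 12) (Fin 12) ℤ) := by
    ext i j
    have h := hform (Pi.single i 1) (Pi.single j 1)
    rw [Matrix.mulVec_mulVec, Matrix.mulVec_single_one, Matrix.mulVec_single_one] at h
    simp only [Matrix.mul_apply', Matrix.smul_apply, smul_eq_mul]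
    refine Eq.trans ?_ (h.trans ?_)
    · rfl
    · simp [Matrix.one_apply, Pi.single_apply, eq_comm]
  have hzero : T2ᵀ * (G2 * T2) = 0 := by
    have h := congrArg (fun M : Matrix (Fin 12) (Fin 12) ℤ => M.map f) hTGT
    simp only [Matrix.map_mul] at h
    refine Eq.trans h ?_
    ext i j
    simp only [Matrix.map_apply, Matrix.smul_apply, smul_eq_mul, map_mul, Matrix.zero_apply]
    have h2 : f (-2) = 0 := by decide
    rw [h2, zero_mul]
  have hle := Matrix.rank_add_rank_le_card_of_mul_eq_zero hzero
  rw [Matrix.rank_transpose, Matrix.rank_mul_eq_right_of_isUnit_det _ _ hG2, hrank] at hle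
  simp at hle
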